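/- Let K_ℝ be the field of rational functions over ℝ in the nine coordinates of a pair (u, C) of a vector u ∈ ℝ³ and a symmetric real 3×3 matrix C, equipped with the action of SO₃(ℝ) by field automorphisms induced by precomposition with the linear action (u,C) ↦ (gu, gCgᵀ). Then the fixed field K_ℝ^{SO₃(ℝ)} is purely transcendental over ℝ, equal to the subfield ℝ(f₁, …, f₆) generated by the six invariants f₁, …, f₆, which are algebraically independent over ℝ. (The field of real-valued rational local unitary invariants of symmetric mixed states of two qubits is rational of degree 6.) -/

import Mathlib

open Matrix MvPolynomial

/-- `SO₃(ℝ)`: real 3×3 matrices with `gᵀ g = 1` and `det g = 1`. -/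
def SO3R (g : Matrix (Fin 3) (Fin 3) ℝ) : Prop := gᵀ * g = 1 ∧ g.det = 1

/-- The generic vector `u = (u₁, u₂, u₃)` with real polynomial entries. -/
noncomputable def symUR : Fin 3 → MvPolynomial (Fin 9) ℝ := ![X 0, X 1, X 2]

/-- The generic symmetric real matrix `C = (cᵢⱼ)` with polynomial entries
`c₁₁, c₁₂, c₁₃, c₂₂, c₂₃, c₃₃`. -/
noncomputable def symCR : Matrix (Fin 3) (Fin 3) (MvPolynomial (Fin 9) ℝ) :=
  !![X 3, X 4, X 5; X 4, X 6, X 7; X 5, X 7, X 8]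

/-- The six invariants `f₁, …, f₆` as real polynomials in the nine coordinates of
`(u, C)`, where `v = u × (Cu)`, `w = u × v`:  `f₁ = u·u`, `f₂ = v·v`, `f₃ = u·(Cu)`,
`f₄ = v·(Cv)`, `f₅ = w·(Cw)`, `f₆ = w·(Cv)`. -/
noncomputable def symFpolyR : Fin 6 → MvPolynomial (Fin 9) ℝ :=
  let u := symUR
  let C := symCR
  let v := crossProduct u (C *ᵥ u)
  let w := crossProduct u v
  ![u ⬝ᵥ u, v ⬝ᵥ v, u ⬝ᵥ (C *ᵥ u), v ⬝ᵥ (C *ᵥ v), w ⬝ᵥ (C *ᵥ w), w ⬝ᵥ (C *ᵥ v)]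

/-- The SO₃(ℝ)-action on the nine coordinates of a real pair `(u, C)` with `C`
symmetric, given by `(u, C) ↦ (gu, gCgᵀ)`. -/
noncomputable def symActR (g : Matrix (Fin 3) (Fin 3) ℝ) (x : Fin 9 → ℝ) : Fin 9 → ℝ :=
  let u : Fin 3 → ℝ := ![x 0, x 1, x 2]
  let C : Matrix (Fin 3) (Fin 3) ℝ := !![x 3, x 4, x 5; x 4, x 6, x 7; x 5, x 7, x 8]
  let u' := g *ᵥ u
  let C' := g * C * gᵀ
  ![u' 0, u' 1, u' 2, C' 0 0, C' 0 1, C' 0 2, C' 1 1, C' 1 2, C' 2 2]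


/-- The vector `u` of a point `(u, C)` in coordinates. -/
def coordVec (x : Fin 9 → ℝ) : Fin 3 → ℝ := ![x 0, x 1, x 2]

/-- The symmetric matrix `C` of a point `(u, C)` in coordinates. -/
def coordMat (x : Fin 9 → ℝ) : Matrix (Fin 3) (Fin 3) ℝ :=
  !![x 3, x 4, x 5; x 4, x 6, x 7; x 5, x 7, x 8]

/-- The values of the six invariants at `(u, C)`. -/
def invariantValues (u : Fin 3 → ℝ) (C : Matrix (Fin 3) (Fin 3) ℝ) : Fin 6 → ℝ :=
  let v := crossProduct u (C *ᵥ u)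
  let w := crossProduct u v
  ![u ⬝ᵥ u, v ⬝ᵥ v, u ⬝ᵥ (C *ᵥ u), v ⬝ᵥ (C *ᵥ v), w ⬝ᵥ (C *ᵥ w), w ⬝ᵥ (C *ᵥ v)]

lemma coordMat_transpose (x : Fin 9 → ℝ) : (coordMat x)ᵀ = coordMat x := by
  ext i j; fin_cases i <;> fin_cases j <;> rfl

lemma coord_ext {x y : Fin 9 → ℝ} (hu : coordVec x = coordVec y)
    (hC : coordMat x = coordMat y) : x = y := by
  ext i
  fin_cases i
  · exact congrFun hu 0
  · exact congrFun hu 1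
  · exact congrFun hu 2
  · exact congrFun (congrFun hC 0) 0
  · exact congrFun (congrFun hC 0) 1
  · exact congrFun (congrFun hC 0) 2
  · exact congrFun (congrFun hC 1) 1
  · exact congrFun (congrFun hC 1) 2
  · exact congrFun (congrFun hC 2) 2

lemma coordVec_symActR (g : Matrix (Fin 3) (Fin 3) ℝ) (x : Fin 9 → ℝ) :
    coordVec (symActR g x) = g *ᵥ coordVec x := by
  ext i; fin_cases i <;> rfl

lemma coordMat_symActR (g : Matrix (Fin 3) (Fin 3) ℝ) (x : Fin 9 → ℝ) :
    coordMat (symActR g x) = g * coordMat x * gᵀ := by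
  have h : (g * coordMat x * gᵀ)ᵀ = g * coordMat x * gᵀ := by
    simp [Matrix.transpose_mul, coordMat_transpose, Matrix.mul_assoc]
  have h' (i j) := congrFun (congrFun h i) j
  simp only [Matrix.transpose_apply] at h'
  ext i j
  fin_cases i <;> fin_cases j <;> first | rfl | exact h' _ _

lemma symActR_mul (g h : Matrix (Fin 3) (Fin 3) ℝ) (x : Fin 9 → ℝ) :
    symActR (g * h) x = symActR g (symActR h x) := by
  apply coord_ext
  · simp [coordVec_symActR]
  · simp [coordMat_symActR, Matrix.transpose_mul, Matrix.mul_assoc]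

lemma symActR_one (x : Fin 9 → ℝ) : symActR 1 x = x :=
  coord_ext (by simp [coordVec_symActR]) (by simp [coordMat_symActR])

lemma SO3R.mul_transpose {g : Matrix (Fin 3) (Fin 3) ℝ} (hg : SO3R g) : g * gᵀ = 1 :=
  mul_eq_one_comm.mp hg.1

lemma SO3R.transpose {g : Matrix (Fin 3) (Fin 3) ℝ} (hg : SO3R g) : SO3R gᵀ :=
  ⟨by simpa using hg.mul_transpose, by simpa using hg.2⟩

lemma SO3R.mul {g h : Matrix (Fin 3) (Fin 3) ℝ} (hg : SO3R g) (hh : SO3R h) : SO3R (g * h) := by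
  refine ⟨?_, by simp [hg.2, hh.2]⟩
  rw [Matrix.transpose_mul, Matrix.mul_assoc, ← Matrix.mul_assoc gᵀ, hg.1, Matrix.one_mul, hh.1]

lemma transpose_mulVec_cross (g : Matrix (Fin 3) (Fin 3) ℝ) (a b : Fin 3 → ℝ) :
    gᵀ *ᵥ crossProduct (g *ᵥ a) (g *ᵥ b) = g.det • crossProduct a b := by
  ext i
  fin_cases i <;>
  · simp [cross_apply, Matrix.mulVec, dotProduct, Fin.sum_univ_three, Matrix.det_fin_three]
    ring

lemma SO3R.cross_mulVec {g : Matrix (Fin 3) (Fin 3) ℝ} (hg : SO3R g) (a b : Fin 3 → ℝ) :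
    crossProduct (g *ᵥ a) (g *ᵥ b) = g *ᵥ crossProduct a b := by
  have h := congrArg (g *ᵥ ·) (transpose_mulVec_cross g a b)
  simpa [hg.mul_transpose, hg.2] using h

lemma SO3R.dot_mulVec {g : Matrix (Fin 3) (Fin 3) ℝ} (hg : SO3R g) (a b : Fin 3 → ℝ) :
    (g *ᵥ a) ⬝ᵥ (g *ᵥ b) = a ⬝ᵥ b := by
  rw [Matrix.dotProduct_mulVec, ← Matrix.mulVec_transpose, Matrix.mulVec_mulVec, hg.1,
    Matrix.one_mulVec]

lemma SO3R.conj_mulVec {g : Matrix (Fin 3) (Fin 3) ℝ} (hg : SO3R g)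
    (C : Matrix (Fin 3) (Fin 3) ℝ) (a : Fin 3 → ℝ) :
    (g * C * gᵀ) *ᵥ (g *ᵥ a) = g *ᵥ (C *ᵥ a) := by
  rw [Matrix.mulVec_mulVec, Matrix.mul_assoc, hg.1, Matrix.mul_one, Matrix.mulVec_mulVec]

lemma SO3R.invariantValues {g : Matrix (Fin 3) (Fin 3) ℝ} (hg : SO3R g)
    (u : Fin 3 → ℝ) (C : Matrix (Fin 3) (Fin 3) ℝ) :
    invariantValues (g *ᵥ u) (g * C * gᵀ) = invariantValues u C := by
  simp only [_root_.invariantValues, hg.conj_mulVec, hg.cross_mulVec, hg.dot_mulVec]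

lemma eval_symFpolyR (x : Fin 9 → ℝ) :
    (fun i => eval x (symFpolyR i)) = invariantValues (coordVec x) (coordMat x) := by
  ext i
  fin_cases i <;>
    simp [symFpolyR, invariantValues, symUR, symCR, coordVec, coordMat, cross_apply,
      Matrix.mulVec, dotProduct, Fin.sum_univ_three]

lemma eval_bind₁_eq {σ τ : Type*} (S : σ → MvPolynomial τ ℝ) (p : MvPolynomial σ ℝ) (y : τ → ℝ) :
    eval y (bind₁ S p) = eval (fun i => eval y (S i)) p := by
  rw [eval, eval₂Hom_bind₁]
  rfl

lemma eval_aeval_symFpolyR (x : Fin 9 → ℝ) (R : MvPolynomial (Fin 6) ℝ) :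
    eval x (aeval symFpolyR R) = eval (invariantValues (coordVec x) (coordMat x)) R := by
  rw [← eval_symFpolyR]
  exact eval_bind₁_eq _ _ _

lemma exists_poly_symActR (g : Matrix (Fin 3) (Fin 3) ℝ) :
    ∃ A : Fin 9 → MvPolynomial (Fin 9) ℝ, ∀ x, (fun i => eval x (A i)) = symActR g x := by
  let u := g.map C *ᵥ symUR
  let M := g.map C * symCR * (g.map C)ᵀ
  refine ⟨![u 0, u 1, u 2, M 0 0, M 0 1, M 0 2, M 1 1, M 1 2, M 2 2], fun x => ?_⟩
  ext i
  fin_cases i <;>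
    simp [u, M, symActR, symUR, symCR, Matrix.mul_apply, Matrix.mulVec, dotProduct,
      Fin.sum_univ_three]

/-- The points of the slice: `u` on the first axis and `C` with vanishing entry `c₁₂`. -/
def slicePoint (y : Fin 6 → ℝ) : Fin 9 → ℝ :=
  ![y 0, 0, 0, y 2, 0, y 1, y 3, y 0 * y 4, y 5]

lemma exists_poly_slicePoint :
    ∃ S : Fin 9 → MvPolynomial (Fin 6) ℝ, ∀ y, (fun i => eval y (S i)) = slicePoint y := by
  refine ⟨![X 0, 0, 0, X 2, 0, X 1, X 3, X 0 * X 4, X 5], fun y => ?_⟩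
  ext i
  fin_cases i <;> simp [slicePoint]

lemma exists_poly_symActR_slicePoint (g : Matrix (Fin 3) (Fin 3) ℝ) (p : MvPolynomial (Fin 9) ℝ) :
    ∃ r : MvPolynomial (Fin 6) ℝ, ∀ y, eval y r = eval (symActR g (slicePoint y)) p := by
  obtain ⟨A, hA⟩ := exists_poly_symActR g
  obtain ⟨S, hS⟩ := exists_poly_slicePoint
  refine ⟨bind₁ S (bind₁ A p), fun y => ?_⟩
  rw [eval_bind₁_eq, eval_bind₁_eq, hS, hA]

lemma invariantValues_slicePoint (y : Fin 6 → ℝ) :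
    invariantValues (coordVec (slicePoint y)) (coordMat (slicePoint y)) =
      ![y 0 ^ 2, y 0 ^ 4 * y 1 ^ 2, y 0 ^ 2 * y 2, y 0 ^ 4 * y 1 ^ 2 * y 3,
        y 0 ^ 6 * y 1 ^ 2 * y 5, y 0 ^ 6 * y 1 ^ 2 * y 4] := by
  ext i
  fin_cases i <;>
  · simp [invariantValues, coordVec, coordMat, slicePoint, cross_apply, Matrix.mulVec, dotProduct,
      Fin.sum_univ_three]
    try ring

/-- The squares of the first two slice coordinates and the remaining slice coordinates, as
rational functions of the invariants. -/
noncomputable def sliceInverse (t : Fin 6 → ℝ) : Fin 6 → ℝ :=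
  ![t 0, t 1 / t 0 ^ 2, t 2 / t 0, t 3 / t 1, t 5 / (t 0 * t 1), t 4 / (t 0 * t 1)]

/-- Squaring of the first two coordinates. -/
def squareTwo (y : Fin 6 → ℝ) : Fin 6 → ℝ := ![y 0 ^ 2, y 1 ^ 2, y 2, y 3, y 4, y 5]

/-- Scaling of the first two coordinates. -/
def scaleTwo (s t : ℝ) (y : Fin 6 → ℝ) : Fin 6 → ℝ := ![s * y 0, t * y 1, y 2, y 3, y 4, y 5]

lemma squareTwo_eq_sliceInverse {y : Fin 6 → ℝ} (h0 : y 0 ≠ 0) (h1 : y 1 ≠ 0) :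
    squareTwo y = sliceInverse
      (invariantValues (coordVec (slicePoint y)) (coordMat (slicePoint y))) := by
  rw [invariantValues_slicePoint]
  ext i
  fin_cases i <;> simp [squareTwo, sliceInverse] <;> field_simp

lemma exists_slicePoint_of_pos {t : Fin 6 → ℝ} (h0 : 0 < t 0) (h1 : 0 < t 1) :
    ∃ y, invariantValues (coordVec (slicePoint y)) (coordMat (slicePoint y)) = t := by
  refine ⟨![√(t 0), √(t 1) / t 0, t 2 / t 0, t 3 / t 1, t 5 / (t 0 * t 1), t 4 / (t 0 * t 1)], ?_⟩
  have e0 := Real.sq_sqrt h0.le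
  have e1 := Real.sq_sqrt h1.le
  have e4 : √(t 0) ^ 4 = t 0 ^ 2 := by rw [← e0]; ring_nf; simp [e0]
  have e6 : √(t 0) ^ 6 = t 0 ^ 3 := by rw [← e0]; ring_nf; simp [e0]
  rw [invariantValues_slicePoint]
  ext i
  fin_cases i <;> simp [div_pow, e0, e1, e4, e6] <;> field_simp

lemma exists_SO3R_of_orthogonal {u v : Fin 3 → ℝ} (hu : 0 < u ⬝ᵥ u) (hv : 0 < v ⬝ᵥ v)
    (huv : u ⬝ᵥ v = 0) :
    ∃ g, SO3R g ∧ ∃ α β : ℝ, α ≠ 0 ∧ g 0 = α • u ∧ g 1 = β • v ∧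
      g *ᵥ u = ![α * (u ⬝ᵥ u), 0, 0] := by
  obtain ⟨α, hα, hα'⟩ : ∃ α : ℝ, α ≠ 0 ∧ α ^ 2 * (u ⬝ᵥ u) = 1 :=
    ⟨(√(u ⬝ᵥ u))⁻¹, by positivity, by rw [inv_pow, Real.sq_sqrt hu.le, inv_mul_cancel₀ hu.ne']⟩
  obtain ⟨β, hβ'⟩ : ∃ β : ℝ, β ^ 2 * (v ⬝ᵥ v) = 1 :=
    ⟨(√(v ⬝ᵥ v))⁻¹, by rw [inv_pow, Real.sq_sqrt hv.le, inv_mul_cancel₀ hv.ne']⟩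
  have hvu : v ⬝ᵥ u = 0 := by rw [dotProduct_comm, huv]
  have huw : u ⬝ᵥ crossProduct u v = 0 := dot_self_cross u v
  have hvw : v ⬝ᵥ crossProduct u v = 0 := dot_cross_self u v
  have hwu : crossProduct u v ⬝ᵥ u = 0 := by rw [dotProduct_comm, huw]
  have hwv : crossProduct u v ⬝ᵥ v = 0 := by rw [dotProduct_comm, hvw]
  have hww : crossProduct u v ⬝ᵥ crossProduct u v = (u ⬝ᵥ u) * (v ⬝ᵥ v) := by
    rw [cross_dot_cross, huv]; ring
  let g : Matrix (Fin 3) (Fin 3) ℝ := ![α • u, β • v, (α * β) • crossProduct u v]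
  have hg : g * gᵀ = 1 := by
    ext i j
    have hij : (g * gᵀ) i j = g i ⬝ᵥ g j := rfl
    rw [hij]
    fin_cases i <;> fin_cases j <;>
      simp [g, huv, hvu, huw, hvw, hwu, hwv, hww] <;> grind
  have hdet : g.det = 1 := by
    rw [← triple_product_eq_det]
    have : u ⬝ᵥ crossProduct v (crossProduct u v) = (u ⬝ᵥ u) * (v ⬝ᵥ v) := by
      rw [triple_product_permutation, triple_product_permutation, hww]
    simp [this]
    grind
  refine ⟨g, ⟨mul_eq_one_comm.mp hg, hdet⟩, α, β, hα, rfl, rfl, ?_⟩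
  ext i
  have hi : (g *ᵥ u) i = g i ⬝ᵥ u := rfl
  rw [hi]
  fin_cases i <;> simp [g, hvu, hwu]

/-- Every point at which `f₁` and `f₂` do not vanish has a slice point in its orbit. -/
lemma exists_symActR_eq_slicePoint {x : Fin 9 → ℝ}
    (h0 : invariantValues (coordVec x) (coordMat x) 0 ≠ 0)
    (h1 : invariantValues (coordVec x) (coordMat x) 1 ≠ 0) :
    ∃ g, SO3R g ∧ ∃ y, y 0 ≠ 0 ∧ y 1 ≠ 0 ∧ symActR g x = slicePoint y := by
  set u := coordVec x
  set M := coordMat x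
  have nonneg (a : Fin 3 → ℝ) : 0 ≤ a ⬝ᵥ a := Finset.sum_nonneg fun i _ => mul_self_nonneg _
  obtain ⟨g, hg, α, β, hα, hg0, hg1, hgu⟩ := exists_SO3R_of_orthogonal
    (lt_of_le_of_ne (nonneg u) (Ne.symm h0))
    (lt_of_le_of_ne (nonneg (crossProduct u (M *ᵥ u))) (Ne.symm h1)) (dot_self_cross _ _)
  have hM01 : (g * M * gᵀ) 0 1 = 0 := by
    have : (g * M * gᵀ) 0 1 = (g 0 ᵥ* M) ⬝ᵥ g 1 := rfl
    rw [this, hg0, hg1, ← Matrix.mulVec_transpose, coordMat_transpose, Matrix.mulVec_smul,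
      smul_dotProduct, dotProduct_smul, dot_cross_self, smul_zero, smul_zero]
  rw [← coordMat_symActR] at hM01
  rw [← coordVec_symActR] at hgu
  obtain ⟨z, hz⟩ : ∃ z, z = symActR g x := ⟨_, rfl⟩
  rw [← hz] at hM01 hgu
  have hz0 : z 0 ≠ 0 := by
    have : z 0 = α * (u ⬝ᵥ u) := congrFun hgu 0
    rw [this]
    exact mul_ne_zero hα h0
  have hzy : z = slicePoint ![z 0, z 5, z 3, z 6, z 7 / z 0, z 8] := by
    ext i
    fin_cases i
    all_goals try rfl
    · exact congrFun hgu 1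
    · exact congrFun hgu 2
    · exact hM01
    · simp [slicePoint]
      field_simp
  refine ⟨g, hg, _, hz0, fun h => h1 ?_, hz.symm.trans hzy⟩
  rw [← hg.invariantValues, ← coordVec_symActR, ← coordMat_symActR, ← hz, hzy,
    invariantValues_slicePoint]
  simp only [h]
  simp

theorem symFpolyR_algebraicIndependent : AlgebraicIndependent ℝ symFpolyR := by
  rw [algebraicIndependent_iff]
  intro R hR
  refine MvPolynomial.funext_set (fun _ => Set.Ioi 0) (fun _ => Set.Ioi_infinite 0) fun t ht => ?_
  obtain ⟨y, hy⟩ := exists_slicePoint_of_pos (ht 0 trivial) (ht 1 trivial)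
  rw [← hy, ← eval_aeval_symFpolyR, hR, map_zero, map_zero]


lemma exists_sum_scaleTwo (R : MvPolynomial (Fin 6) ℝ) :
    ∃ E : MvPolynomial (Fin 6) ℝ, ∀ y, eval y R + eval (scaleTwo (-1) 1 y) R +
      eval (scaleTwo 1 (-1) y) R + eval (scaleTwo (-1) (-1) y) R = eval (squareTwo y) E := by
  suffices h : ∃ E₀ E₁ E₂ E₃ : MvPolynomial (Fin 6) ℝ, ∀ y, eval y R =
      eval (squareTwo y) E₀ + y 0 * eval (squareTwo y) E₁ + y 1 * eval (squareTwo y) E₂ +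
        y 0 * y 1 * eval (squareTwo y) E₃ by
    obtain ⟨E₀, E₁, E₂, E₃, h⟩ := h
    refine ⟨4 * E₀, fun y => ?_⟩
    have e (s t : ℝ) (hs : s ^ 2 = 1) (ht : t ^ 2 = 1) :
        squareTwo (scaleTwo s t y) = squareTwo y := by
      simp [squareTwo, scaleTwo, mul_pow, hs, ht]
    rw [h y, h (scaleTwo (-1) 1 y), h (scaleTwo 1 (-1) y), h (scaleTwo (-1) (-1) y),
      e _ _ (by norm_num) (by norm_num), e _ _ (by norm_num) (by norm_num),
      e _ _ (by norm_num) (by norm_num)]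
    simp [scaleTwo]
    ring
  induction R using MvPolynomial.induction_on with
  | C a => exact ⟨C a, 0, 0, 0, by simp⟩
  | add p q hp hq =>
    obtain ⟨E₀, E₁, E₂, E₃, hE⟩ := hp
    obtain ⟨G₀, G₁, G₂, G₃, hG⟩ := hq
    refine ⟨E₀ + G₀, E₁ + G₁, E₂ + G₂, E₃ + G₃, fun y => ?_⟩
    simp only [map_add, hE, hG]
    ring
  | mul_X p i hp =>
    obtain ⟨E₀, E₁, E₂, E₃, hE⟩ := hp
    by_cases h0 : i = 0
    · subst h0
      refine ⟨X 0 * E₁, E₀, X 0 * E₃, E₂, fun y => ?_⟩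
      simp only [map_mul, hE, eval_X, show squareTwo y 0 = y 0 ^ 2 from rfl]
      ring
    by_cases h1 : i = 1
    · subst h1
      refine ⟨X 1 * E₂, X 1 * E₃, E₀, E₁, fun y => ?_⟩
      simp only [map_mul, hE, eval_X, show squareTwo y 1 = y 1 ^ 2 from rfl]
      ring
    refine ⟨X i * E₀, X i * E₁, X i * E₂, X i * E₃, fun y => ?_⟩
    have hi : squareTwo y i = y i := by fin_cases i <;> first | rfl | contradiction
    simp only [map_mul, hE, eval_X, hi]
    ring

lemma exists_clear_denominators (R : MvPolynomial (Fin 6) ℝ) :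
    ∃ (N : ℕ) (P : MvPolynomial (Fin 6) ℝ), ∀ t, t 0 ≠ 0 → t 1 ≠ 0 →
      eval t P = (t 0 * t 1) ^ N * eval (sliceInverse t) R := by
  have hn : ∃ n : Fin 6 → MvPolynomial (Fin 6) ℝ, ∀ i t, t 0 ≠ 0 → t 1 ≠ 0 →
      eval t (n i) = (t 0 * t 1) ^ 2 * sliceInverse t i := by
    refine ⟨![X 0 ^ 3 * X 1 ^ 2, X 1 ^ 3, X 0 * X 1 ^ 2 * X 2, X 0 ^ 2 * X 1 * X 3,
      X 0 * X 1 * X 5, X 0 * X 1 * X 4], fun i t h0 h1 => ?_⟩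
    fin_cases i <;> simp [sliceInverse] <;> field_simp
  obtain ⟨n, hn⟩ := hn
  induction R using MvPolynomial.induction_on with
  | C a => exact ⟨0, C a, by simp⟩
  | add p q hp hq =>
    obtain ⟨N, P, hP⟩ := hp
    obtain ⟨M, Q, hQ⟩ := hq
    refine ⟨N + M, P * (X 0 * X 1) ^ M + Q * (X 0 * X 1) ^ N, fun t h0 h1 => ?_⟩
    simp only [map_add, map_mul, map_pow, eval_X, hP t h0 h1, hQ t h0 h1]
    ring
  | mul_X p i hp =>
    obtain ⟨N, P, hP⟩ := hp
    refine ⟨N + 2, P * n i, fun t h0 h1 => ?_⟩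
    simp only [map_mul, eval_X, hP t h0 h1, hn i t h0 h1]
    ring

lemma scaleTwo_scaleTwo (s t s' t' : ℝ) (y : Fin 6 → ℝ) :
    scaleTwo s t (scaleTwo s' t' y) = scaleTwo (s * s') (t * t') y := by
  simp [scaleTwo, mul_assoc]

lemma scaleTwo_one_one (y : Fin 6 → ℝ) : scaleTwo 1 1 y = y := by
  ext i; fin_cases i <;> simp [scaleTwo]

lemma exists_poly_scaleTwo (s t : ℝ) (R : MvPolynomial (Fin 6) ℝ) :
    ∃ R' : MvPolynomial (Fin 6) ℝ, ∀ y, eval y R' = eval (scaleTwo s t y) R := by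
  refine ⟨bind₁ ![C s * X 0, C t * X 1, X 2, X 3, X 4, X 5] R, fun y => ?_⟩
  rw [eval_bind₁_eq]
  congr 2
  ext i
  fin_cases i <;> simp [scaleTwo]

/-- A fraction invariant under sign changes of the first two variables can be expanded so that
numerator and denominator are polynomials in the squares of these variables. -/
lemma exists_fraction_squareTwo {p q : MvPolynomial (Fin 6) ℝ} (hq : q ≠ 0)
    (h : ∀ s t : ℝ, s ^ 2 = 1 → t ^ 2 = 1 → ∀ y,
      eval (scaleTwo s t y) p * eval y q = eval y p * eval (scaleTwo s t y) q) :
    ∃ P Q r : MvPolynomial (Fin 6) ℝ, r ≠ 0 ∧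
      (∀ y, eval (squareTwo y) P = eval y p * eval y r) ∧
      ∀ y, eval (squareTwo y) Q = eval y q * eval y r := by
  have scaled (s t : ℝ) (hs : s ^ 2 = 1) (ht : t ^ 2 = 1) :
      ∃ q' : MvPolynomial (Fin 6) ℝ, q' ≠ 0 ∧ ∀ y, eval y q' = eval (scaleTwo s t y) q := by
    obtain ⟨q', hq'⟩ := exists_poly_scaleTwo s t q
    refine ⟨q', fun h0 => hq (MvPolynomial.funext fun y => ?_), hq'⟩
    have := hq' (scaleTwo s t y)
    rw [scaleTwo_scaleTwo, ← sq, ← sq, hs, ht, scaleTwo_one_one] at this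
    rw [← this, h0, map_zero, map_zero]
  obtain ⟨q₁, hne₁, h₁⟩ := scaled (-1) 1 (by norm_num) (by norm_num)
  obtain ⟨q₂, hne₂, h₂⟩ := scaled 1 (-1) (by norm_num) (by norm_num)
  obtain ⟨q₃, hne₃, h₃⟩ := scaled (-1) (-1) (by norm_num) (by norm_num)
  obtain ⟨P, hP⟩ := exists_sum_scaleTwo (p * (q₁ * q₂ * q₃))
  obtain ⟨Q, hQ⟩ := exists_sum_scaleTwo (q * (q₁ * q₂ * q₃))
  refine ⟨P, Q, 4 * (q₁ * q₂ * q₃), by simp [hne₁, hne₂, hne₃], fun y => ?_, fun y => ?_⟩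
  · have e₁ := h (-1) 1 (by norm_num) (by norm_num) y
    have e₂ := h 1 (-1) (by norm_num) (by norm_num) y
    have e₃ := h (-1) (-1) (by norm_num) (by norm_num) y
    rw [← hP]
    simp only [map_mul, h₁, h₂, h₃, scaleTwo_scaleTwo, mul_neg, mul_one, neg_neg,
      scaleTwo_one_one, map_ofNat]
    generalize eval (scaleTwo (-1) 1 y) p = p₁ at *
    generalize eval (scaleTwo 1 (-1) y) p = p₂ at *
    generalize eval (scaleTwo (-1) (-1) y) p = p₃ at *
    generalize eval (scaleTwo (-1) 1 y) q = a₁ at *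
    generalize eval (scaleTwo 1 (-1) y) q = a₂ at *
    generalize eval (scaleTwo (-1) (-1) y) q = a₃ at *
    linear_combination a₂ * a₃ * e₁ + a₁ * a₃ * e₂ + a₁ * a₂ * e₃
  · rw [← hQ]
    simp only [map_mul, h₁, h₂, h₃, scaleTwo_scaleTwo, mul_neg, mul_one, neg_neg,
      scaleTwo_one_one, map_ofNat]
    ring

lemma exists_SO3R_scaleTwo {s t : ℝ} (hs : s ^ 2 = 1) (ht : t ^ 2 = 1) :
    ∃ g, SO3R g ∧ ∀ y, symActR g (slicePoint y) = slicePoint (scaleTwo s t y) := by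
  refine ⟨Matrix.diagonal ![s, t, s * t], ⟨?_, ?_⟩, fun y => ?_⟩
  · rw [Matrix.diagonal_transpose, Matrix.diagonal_mul_diagonal, ← Matrix.diagonal_one]
    congr 1
    ext i
    fin_cases i <;> simp <;> grind
  · simp [Fin.prod_univ_three]
    grind
  · apply coord_ext
    · rw [coordVec_symActR]
      ext i
      rw [Matrix.mulVec_diagonal]
      fin_cases i <;> simp [coordVec, slicePoint, scaleTwo]
    · rw [coordMat_symActR]
      ext i j
      rw [Matrix.diagonal_transpose, Matrix.mul_diagonal, Matrix.diagonal_mul]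
      fin_cases i <;> fin_cases j <;> simp [coordMat, slicePoint, scaleTwo] <;> grind

lemma invariant_fraction_orbit {p q : MvPolynomial (Fin 9) ℝ}
    (h : ∀ g : Matrix (Fin 3) (Fin 3) ℝ, SO3R g → ∀ x : Fin 9 → ℝ,
      eval (symActR g x) p * eval x q = eval x p * eval (symActR g x) q)
    {g k : Matrix (Fin 3) (Fin 3) ℝ} (hg : SO3R g) (hk : SO3R k) (x : Fin 9 → ℝ) :
    eval (symActR g x) p * eval (symActR k x) q =
      eval (symActR k x) p * eval (symActR g x) q := by
  have := h (g * kᵀ) (hg.mul hk.transpose) (symActR k x)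
  rwa [← symActR_mul, Matrix.mul_assoc, hk.1, Matrix.mul_one] at this

lemma symFpolyR_invariant {g : Matrix (Fin 3) (Fin 3) ℝ} (hg : SO3R g) (x : Fin 9 → ℝ)
    (R : MvPolynomial (Fin 6) ℝ) :
    eval (symActR g x) (aeval symFpolyR R) = eval x (aeval symFpolyR R) := by
  rw [eval_aeval_symFpolyR, eval_aeval_symFpolyR, coordVec_symActR, coordMat_symActR,
    hg.invariantValues]

lemma exists_eval_ne_zero {σ : Type*} {p : MvPolynomial σ ℝ} (hp : p ≠ 0) :
    ∃ x, eval x p ≠ 0 := by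
  by_contra! h
  exact hp (MvPolynomial.funext fun x => by rw [h, map_zero])

theorem invariant_of_eq_aeval_symFpolyR {p q : MvPolynomial (Fin 9) ℝ}
    {P Q : MvPolynomial (Fin 6) ℝ} (hQ : aeval symFpolyR Q ≠ 0)
    (h : p * aeval symFpolyR Q = aeval symFpolyR P * q)
    {g : Matrix (Fin 3) (Fin 3) ℝ} (hg : SO3R g) (x : Fin 9 → ℝ) :
    eval (symActR g x) p * eval x q = eval x p * eval (symActR g x) q := by
  obtain ⟨A, hA⟩ := exists_poly_symActR g
  have hA' (r : MvPolynomial (Fin 9) ℝ) (x) : eval x (bind₁ A r) = eval (symActR g x) r := by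
    rw [eval_bind₁_eq, hA]
  suffices bind₁ A p * q = p * bind₁ A q by
    simpa only [map_mul, hA'] using congrArg (eval x) this
  refine mul_left_cancel₀ hQ (MvPolynomial.funext fun z => ?_)
  have e := congrArg (eval z) h
  have eg := congrArg (eval (symActR g z)) h
  simp only [map_mul, symFpolyR_invariant hg] at e eg
  simp only [map_mul, hA']
  linear_combination eval z q * eg - eval (symActR g z) q * e

theorem exists_aeval_symFpolyR_of_invariant {p q : MvPolynomial (Fin 9) ℝ} (hq : q ≠ 0)
    (h : ∀ g : Matrix (Fin 3) (Fin 3) ℝ, SO3R g → ∀ x : Fin 9 → ℝ,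
      eval (symActR g x) p * eval x q = eval x p * eval (symActR g x) q) :
    ∃ P Q : MvPolynomial (Fin 6) ℝ, aeval symFpolyR Q ≠ 0 ∧
      p * aeval symFpolyR Q = aeval symFpolyR P * q := by
  -- translate so that `q` does not vanish identically on the slice
  obtain ⟨g₀, hg₀, y₀, hy₀⟩ : ∃ g, SO3R g ∧ ∃ y, eval (symActR g (slicePoint y)) q ≠ 0 := by
    obtain ⟨x, hx⟩ := exists_eval_ne_zero (mul_ne_zero (mul_ne_zero hq
      (symFpolyR_algebraicIndependent.ne_zero 0)) (symFpolyR_algebraicIndependent.ne_zero 1))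
    have e (i : Fin 6) : eval x (symFpolyR i) = _ := congrFun (eval_symFpolyR x) i
    rw [map_mul, map_mul, e, e] at hx
    obtain ⟨g, hg, y, -, -, hy⟩ := exists_symActR_eq_slicePoint
      (right_ne_zero_of_mul (left_ne_zero_of_mul hx)) (right_ne_zero_of_mul hx)
    refine ⟨gᵀ, hg.transpose, y, ?_⟩
    rw [← hy, ← symActR_mul, hg.1, symActR_one]
    exact left_ne_zero_of_mul (left_ne_zero_of_mul hx)
  obtain ⟨p₀, hp₀⟩ := exists_poly_symActR_slicePoint g₀ p
  obtain ⟨q₀, hq₀⟩ := exists_poly_symActR_slicePoint g₀ q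
  have hq₀_ne : q₀ ≠ 0 := by
    rintro rfl
    exact hy₀ (by rw [← hq₀, map_zero])
  obtain ⟨P₀, Q₀, r, hr, hP₀, hQ₀⟩ := exists_fraction_squareTwo (p := p₀) hq₀_ne
    fun s t hs ht y => by
      obtain ⟨k, hk, hky⟩ := exists_SO3R_scaleTwo hs ht
      rw [hp₀, hp₀, hq₀, hq₀, ← hky, ← symActR_mul]
      exact invariant_fraction_orbit h (hg₀.mul hk) hg₀ _
  obtain ⟨M, P, hP⟩ := exists_clear_denominators P₀
  obtain ⟨N, Q, hQ⟩ := exists_clear_denominators Q₀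
  refine ⟨P * (X 0 * X 1) ^ (N + 1), Q * (X 0 * X 1) ^ (M + 1), fun hzero => ?_,
    MvPolynomial.funext fun x => ?_⟩
  · obtain ⟨y, hy⟩ := exists_eval_ne_zero (mul_ne_zero (mul_ne_zero (mul_ne_zero hq₀_ne hr)
      (X_ne_zero (R := ℝ) (0 : Fin 6))) (X_ne_zero (R := ℝ) (1 : Fin 6)))
    simp only [map_mul, eval_X, mul_ne_zero_iff] at hy
    obtain ⟨⟨⟨hqy, hry⟩, hy0⟩, hy1⟩ := hy
    have e := congrArg (eval (slicePoint y)) hzero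
    have h0 : invariantValues (coordVec (slicePoint y)) (coordMat (slicePoint y)) 0 ≠ 0 := by
      rw [invariantValues_slicePoint]
      simpa using hy0
    have h1 : invariantValues (coordVec (slicePoint y)) (coordMat (slicePoint y)) 1 ≠ 0 := by
      rw [invariantValues_slicePoint]
      simp [hy0, hy1]
    rw [eval_aeval_symFpolyR, map_mul, hQ _ h0 h1, ← squareTwo_eq_sliceInverse hy0 hy1, hQ₀] at e
    simp only [map_pow, map_mul, eval_X, map_zero] at e
    exact mul_ne_zero (mul_ne_zero (pow_ne_zero _ (mul_ne_zero h0 h1)) (mul_ne_zero hqy hry))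
      (pow_ne_zero _ (mul_ne_zero h0 h1)) e
  · rw [map_mul (eval x), map_mul (eval x), eval_aeval_symFpolyR, eval_aeval_symFpolyR]
    simp only [map_mul, map_pow, eval_X]
    by_cases h0 : invariantValues (coordVec x) (coordMat x) 0 = 0
    · simp [h0]
    by_cases h1 : invariantValues (coordVec x) (coordMat x) 1 = 0
    · simp [h1]
    obtain ⟨g, hg, y, hy0, hy1, hgx⟩ := exists_symActR_eq_slicePoint h0 h1
    have hsq := squareTwo_eq_sliceInverse hy0 hy1
    rw [← hgx, coordVec_symActR, coordMat_symActR, hg.invariantValues] at hsq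
    have e := h (g₀ * g) (hg₀.mul hg) x
    rw [symActR_mul, hgx, ← hp₀, ← hq₀] at e
    rw [hP _ h0 h1, hQ _ h0 h1, ← hsq, hP₀, hQ₀]
    generalize invariantValues (coordVec x) (coordMat x) 0 *
      invariantValues (coordVec x) (coordMat x) 1 = d
    linear_combination -(d ^ (M + N + 1) * eval y r) * e

/-- The field of real-valued rational local unitary invariants of symmetric mixed
states of two qubits is purely transcendental over ℝ, equal to `ℝ(f₁, …, f₆)` with
`f₁, …, f₆` algebraically independent: a real rational function `p/q` is
SO₃(ℝ)-invariant iff it is a rational function of `f₁, …, f₆`. -/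
theorem real_symmetric_invariant_field_rational :
    AlgebraicIndependent ℝ symFpolyR ∧
      ∀ p q : MvPolynomial (Fin 9) ℝ, q ≠ 0 →
        ((∀ g : Matrix (Fin 3) (Fin 3) ℝ, SO3R g → ∀ x : Fin 9 → ℝ,
            eval (symActR g x) p * eval x q = eval x p * eval (symActR g x) q) ↔
          ∃ P Q : MvPolynomial (Fin 6) ℝ, aeval symFpolyR Q ≠ 0 ∧
            p * aeval symFpolyR Q = aeval symFpolyR P * q) := by
  exact ⟨symFpolyR_algebraicIndependent, fun p q hq =>
    ⟨exists_aeval_symFpolyR_of_invariant hq, fun ⟨P, Q, hQ, h⟩ g hg x =>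
      invariant_of_eq_aeval_symFpolyR hQ h hg x⟩⟩
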